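/- Let s₀ > 7/2. There exists C > 0 such that for all u, w ∈ H^{s₀+1}(𝕋): |⟨(H∂_x⁴u)Hw, HJw⟩ − ⟨u∂_x⁴w, HJw⟩ − ⟨uHw, J∂_x⁴w⟩ − 4⟨∂_x u, (∂_x w)²⟩| ≤ C‖u‖_{H^{s₀}}‖w‖_{L²}², where H is the Hilbert transform, J the multiplier ψ(ξ)/|ξ|, and ⟨·,·⟩ the L² inner product. -/

import Mathlib

open MeasureTheory Real Complex AddCircle
open scoped BigOperators ENNReal

noncomputable section

instance : Fact (0 < 2 * Real.pi) := ⟨by positivity⟩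

/-- The torus `ℝ/2πℤ`. -/
abbrev Torus := AddCircle (2 * Real.pi)

/-- Fourier coefficient of a real-valued function on the torus
(with respect to the normalized Haar measure). -/
def FC (f : Torus → ℝ) (n : ℤ) : ℂ :=
  fourierCoeff (fun x => (f x : ℂ)) n

/-- Inhomogeneous Sobolev `H^s` norm, via Fourier coefficients:
`‖f‖_{H^s} = ( ∑ ⟨n⟩^{2s} |f̂(n)|² )^{1/2}`. -/
def HsNorm (s : ℝ) (f : Torus → ℝ) : ℝ :=
  Real.sqrt (∑' n : ℤ, ((1 + (n : ℝ) ^ 2) ^ s) * ‖FC f n‖ ^ 2)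

/-- Homogeneous Sobolev norm `‖D^s f‖_{L²} = ( ∑ |n|^{2s} |f̂(n)|² )^{1/2}`,
where `D = 𝓕⁻¹ |ξ| 𝓕`. -/
def DsNorm (s : ℝ) (f : Torus → ℝ) : ℝ :=
  Real.sqrt (∑' n : ℤ, (|(n : ℝ)| ^ (2 * s)) * ‖FC f n‖ ^ 2)

/-- Membership in `H^s(𝕋)` (finiteness of the Sobolev sum). -/
def MemHs (s : ℝ) (f : Torus → ℝ) : Prop :=
  Summable (fun n : ℤ => ((1 + (n : ℝ) ^ 2) ^ s) * ‖FC f n‖ ^ 2)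

/-- `g` is the image of `f` under the Fourier multiplier with symbol `m`. -/
def HasSymbol (m : ℤ → ℂ) (f g : Torus → ℝ) : Prop :=
  ∀ n : ℤ, FC g n = m n * FC f n

/-- Symbol of the Hilbert transform `H`: `-i sgn(n)`. -/
def symH (n : ℤ) : ℂ := -Complex.I * (Int.sign n : ℂ)

/-- Symbol of `D^s = 𝓕⁻¹|ξ|^s𝓕`. -/
def symD (s : ℝ) (n : ℤ) : ℂ := ((|(n : ℝ)| ^ s : ℝ) : ℂ)

/-- Symbol of `∂ₓ`. -/
def symDx (n : ℤ) : ℂ := Complex.I * (n : ℂ)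

/-- Symbol of the smoothed antiderivative `J`: `ψ(ξ)/|ξ|`. -/
def symJ (ψ : ℝ → ℝ) (n : ℤ) : ℂ := ((ψ n / |(n : ℝ)| : ℝ) : ℂ)

/-- `ψ` is a smooth cutoff: `0 ≤ ψ ≤ 1`, `ψ = 1` on `|ξ| ≥ 2`, `ψ = 0` on `|ξ| ≤ 1`. -/
def IsCutoff (ψ : ℝ → ℝ) : Prop :=
  ContDiff ℝ (⊤ : ℕ∞) ψ ∧ (∀ x, 0 ≤ ψ x) ∧ (∀ x, ψ x ≤ 1) ∧
    (∀ x, 2 ≤ |x| → ψ x = 1) ∧ (∀ x, |x| ≤ 1 → ψ x = 0)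

/-- Rapid decay of Fourier coefficients (a model for "sufficiently smooth"). -/
def SmoothFC (f : Torus → ℝ) : Prop :=
  ∀ k : ℕ, Summable (fun n : ℤ => |(n : ℝ)| ^ k * ‖FC f n‖)

/-- `L²` pairing `⟨f, g⟩ = ∫ f g`. -/
def inn (f g : Torus → ℝ) : ℝ := ∫ x : Torus, f x * g x ∂haarAddCircle

/-- Trilinear integral `∫ f g h`. -/
def inn3 (f g h : Torus → ℝ) : ℝ := ∫ x : Torus, f x * g x * h x ∂haarAddCircle

/-- Quadrilinear integral `∫ f g h k`. -/
def inn4 (f g h k : Torus → ℝ) : ℝ :=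
  ∫ x : Torus, f x * g x * h x * k x ∂haarAddCircle


/-- Integration over the torus, as a continuous functional on continuous functions. -/
def integralOnTorus : C(Torus, ℂ) →L[ℂ] ℂ :=
  LinearMap.mkContinuous
    { toFun := fun k => ∫ x, k x ∂haarAddCircle
      map_add' := fun k l => integral_add
        (k.continuous.integrable_of_hasCompactSupport (HasCompactSupport.of_compactSpace _))
        (l.continuous.integrable_of_hasCompactSupport (HasCompactSupport.of_compactSpace _))
      map_smul' := fun c k => integral_const_mul c _ } 1
    (fun k => by
      have := norm_integral_le_of_norm_le_const (μ := haarAddCircle (T := 2 * Real.pi))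
        (Filter.Eventually.of_forall k.norm_coe_le_norm)
      simpa using this)

theorem integralOnTorus_apply (k : C(Torus, ℂ)) :
    integralOnTorus k = ∫ x, k x ∂haarAddCircle := rfl

theorem hasSum_clm_mul_mul {A : Type*} [NormedRing A] [NormedAlgebra ℂ A] [CompleteSpace A]
    (L : A →L[ℂ] ℂ) (z : A) {ι : Type*} {x y : ι → A} {X Y : A} (hx : HasSum x X)
    (hy : HasSum y Y) (nx : Summable fun i => ‖x i‖) (ny : Summable fun i => ‖y i‖) :
    HasSum (fun p : ι × ι => L (x p.1 * y p.2 * z)) (L (X * Y * z)) :=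
  L.hasSum ((hx.mul hy (summable_mul_of_summable_norm nx ny)).mul_right z)

/-- The integral of a product `f g h` of functions with summable Fourier coefficients,
expanded over pairs of frequencies. -/
theorem hasSum_inn3 {f g h : Torus → ℝ} (hf : Continuous f) (hg : Continuous g)
    (hh : Continuous h) (sf : Summable fun n => ‖FC f n‖) (sg : Summable fun n => ‖FC g n‖) :
    HasSum (fun p : ℤ × ℤ => FC f p.1 * FC g p.2 * FC h (-(p.1 + p.2)))
      ((inn3 f g h : ℝ) : ℂ) := by
  let F : C(Torus, ℂ) := ⟨fun x => (f x : ℂ), by fun_prop⟩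
  let G : C(Torus, ℂ) := ⟨fun x => (g x : ℂ), by fun_prop⟩
  let H : C(Torus, ℂ) := ⟨fun x => (h x : ℂ), by fun_prop⟩
  have hF : HasSum (fun i => FC f i • (fourier i : C(Torus, ℂ))) F :=
    hasSum_fourier_series_of_summable (f := F) (Summable.of_norm sf)
  have hG : HasSum (fun i => FC g i • (fourier i : C(Torus, ℂ))) G :=
    hasSum_fourier_series_of_summable (f := G) (Summable.of_norm sg)
  have nF : Summable fun i => ‖FC f i • (fourier i : C(Torus, ℂ))‖ := by
    simpa [norm_smul, fourier_norm] using sf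
  have nG : Summable fun i => ‖FC g i • (fourier i : C(Torus, ℂ))‖ := by
    simpa [norm_smul, fourier_norm] using sg
  have key := hasSum_clm_mul_mul integralOnTorus H hF hG nF nG
  have hval : integralOnTorus (F * G * H) = ((inn3 f g h : ℝ) : ℂ) := by
    rw [integralOnTorus_apply, inn3, ← integral_complex_ofReal]
    refine integral_congr_ae (Filter.Eventually.of_forall fun x => ?_)
    simp [F, G, H]
  rw [hval] at key
  refine Eq.mpr (congrArg (fun q => HasSum q _) (funext fun p => ?_)) key
  rw [integralOnTorus_apply, FC, FC, FC, fourierCoeff.eq_1 (fun x => (h x : ℂ)),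
    ← integral_const_mul]
  refine integral_congr_ae (Filter.Eventually.of_forall fun x => ?_)
  simp only [neg_neg, fourier_add, ContinuousMap.mul_apply, ContinuousMap.smul_apply,
    smul_eq_mul, H, ContinuousMap.coe_mk]
  ring

theorem HasSymbol.summable_norm_FC {m : ℤ → ℂ} {f g : Torus → ℝ} {v : ℤ → ℝ}
    (h : HasSymbol m f g) (hm : ∀ n, ‖m n‖ ≤ v n) (hf : Summable fun n => v n * ‖FC f n‖) :
    Summable fun n => ‖FC g n‖ := by
  refine Summable.of_nonneg_of_le (fun _ => norm_nonneg _) (fun n => ?_) hf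
  rw [h n, norm_mul]
  exact mul_le_mul_of_nonneg_right (hm n) (norm_nonneg _)

theorem norm_symH_le (n : ℤ) : ‖symH n‖ ≤ 1 := by
  rcases lt_trichotomy n 0 with h | h | h
  · simp [symH, Int.sign_eq_neg_one_of_neg h]
  · simp [symH, h]
  · simp [symH, Int.sign_eq_one_of_pos h]

theorem norm_symDx (n : ℤ) : ‖symDx n‖ = |(n : ℝ)| := by
  simp [symDx]

theorem one_add_abs_pow_three_le (x : ℝ) :
    (1 + |x|) ^ 3 ≤ 3 * (1 + x ^ 2) ^ ((3 : ℝ) / 2) := by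
  have h1 : ((1 + x ^ 2) ^ ((3 : ℝ) / 2)) ^ 2 = (1 + x ^ 2) ^ 3 := by
    rw [← Real.rpow_natCast, ← Real.rpow_mul (by positivity), ← Real.rpow_natCast]
    norm_num
  rw [← pow_le_pow_iff_left₀ (by positivity) (by positivity) (two_ne_zero), mul_pow, h1]
  have h2 : (1 + |x|) ^ 2 ≤ 2 * (1 + x ^ 2) := by
    nlinarith [sq_nonneg (1 - |x|), sq_abs x]
  calc ((1 + |x|) ^ 3) ^ 2 = ((1 + |x|) ^ 2) ^ 3 := by ring
    _ ≤ (2 * (1 + x ^ 2)) ^ 3 := by gcongr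
    _ ≤ 3 ^ 2 * (1 + x ^ 2) ^ 3 := by
      rw [mul_pow]
      gcongr
      norm_num

theorem MemHs.mono {s t : ℝ} (hst : s ≤ t) {f : Torus → ℝ} (hf : MemHs t f) : MemHs s f := by
  refine Summable.of_nonneg_of_le (fun n => by positivity) (fun n => ?_) hf
  gcongr
  nlinarith [sq_nonneg (n : ℝ)]

theorem HsNorm_zero_sq (f : Torus → ℝ) : HsNorm 0 f ^ 2 = ∑' n : ℤ, ‖FC f n‖ ^ 2 := by
  rw [HsNorm, Real.sq_sqrt (tsum_nonneg fun n => by positivity)]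
  simp

/-- The involution of pairs of frequencies `(a, b)` exchanging `b` with `c = -(a + b)`. -/
def swapFreq : ℤ × ℤ ≃ ℤ × ℤ :=
  Function.Involutive.toPerm (fun p => (p.1, -(p.1 + p.2))) fun p => by simp

theorem swapFreq_apply (p : ℤ × ℤ) : swapFreq p = (p.1, -(p.1 + p.2)) := rfl

theorem summable_one_add_sq_rpow {t : ℝ} (ht : 1 / 2 < t) :
    Summable fun n : ℤ => (1 + (n : ℝ) ^ 2) ^ (-t) := by
  refine Summable.of_norm_bounded_eventually
    (Real.summable_abs_int_rpow (b := 2 * t) (by linarith)) ?_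
  have h0 : ∀ᶠ n : ℤ in Filter.cofinite, n ≠ 0 := by
    rw [Filter.eventually_cofinite]
    simp
  filter_upwards [h0] with n hn
  have hn' : (0 : ℝ) < |(n : ℝ)| := by positivity
  rw [Real.norm_of_nonneg (by positivity), neg_mul_eq_mul_neg, Real.rpow_mul hn'.le]
  refine Real.rpow_le_rpow_of_nonpos (by positivity) ?_ (by linarith)
  simp [sq_abs]

/-- Sobolev embedding on the Fourier side: a weighted `ℓ¹` norm of the Fourier coefficients is
controlled by the Sobolev norm. -/
theorem summable_and_tsum_le_HsNorm {s t : ℝ} (hst : 1 / 2 < s - t) {f : Torus → ℝ}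
    (hf : MemHs s f) :
    Summable (fun n : ℤ => (1 + (n : ℝ) ^ 2) ^ (t / 2) * ‖FC f n‖) ∧
      ∑' n : ℤ, (1 + (n : ℝ) ^ 2) ^ (t / 2) * ‖FC f n‖ ≤
        Real.sqrt (∑' n : ℤ, (1 + (n : ℝ) ^ 2) ^ (-(s - t))) * HsNorm s f := by
  have sq_rpow : ∀ (n : ℤ) (r : ℝ),
      ((1 + (n : ℝ) ^ 2) ^ (r / 2)) ^ (2 : ℝ) = (1 + (n : ℝ) ^ 2) ^ r := by
    intro n r
    rw [← Real.rpow_mul (by positivity)]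
    congr 1
    ring
  have e1 : ∀ n : ℤ, ((1 + (n : ℝ) ^ 2) ^ (-(s - t) / 2)) ^ (2 : ℝ) =
      (1 + (n : ℝ) ^ 2) ^ (-(s - t)) := fun n => sq_rpow n _
  have e2 : ∀ n : ℤ, ((1 + (n : ℝ) ^ 2) ^ (s / 2) * ‖FC f n‖) ^ (2 : ℝ) =
      (1 + (n : ℝ) ^ 2) ^ s * ‖FC f n‖ ^ 2 := by
    intro n
    rw [Real.mul_rpow (by positivity) (by positivity), sq_rpow, Real.rpow_two]
  have e3 : ∀ n : ℤ, (1 + (n : ℝ) ^ 2) ^ (-(s - t) / 2) *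
      ((1 + (n : ℝ) ^ 2) ^ (s / 2) * ‖FC f n‖) =
      (1 + (n : ℝ) ^ 2) ^ (t / 2) * ‖FC f n‖ := by
    intro n
    rw [← mul_assoc, ← Real.rpow_add (by positivity)]
    congr 2
    ring
  have h := Real.summable_and_inner_le_Lp_mul_Lq_tsum_of_nonneg
    (f := fun n : ℤ => (1 + (n : ℝ) ^ 2) ^ (-(s - t) / 2))
    (g := fun n : ℤ => (1 + (n : ℝ) ^ 2) ^ (s / 2) * ‖FC f n‖)
    Real.HolderConjugate.two_two (fun n => by positivity) (fun n => by positivity)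
    (by simpa only [e1] using summable_one_add_sq_rpow hst)
    (by simp only [e2]; exact hf)
  simp only [e1, e2, e3, ← Real.sqrt_eq_rpow] at h
  exact h

/-- The real symbol of the trilinear form, at frequencies `a` of `u` and `b`, `c` of `w`,
with `j = ψ(c)/|c|`. -/
def triSym (j : ℤ → ℝ) (a b c : ℤ) : ℝ :=
  (a.sign : ℝ) * b.sign * a ^ 4 * (c.sign * j c) + (b : ℝ) ^ 4 * (c.sign * j c)
    + b.sign * j c * c ^ 4 + 4 * a * b * c

theorem abs_triSym_sub_le {j : ℤ → ℝ} (h0 : ∀ n : ℤ, |n| ≤ 1 → j n = 0)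
    (h1 : ∀ n : ℤ, 2 ≤ |n| → j n = 1 / |(n : ℝ)|) {a b c : ℤ} (habc : a + b + c = 0) :
    |triSym j a b c - if b * c < 0 then 2 * (a : ℝ) ^ 2 * c else 0| ≤ 9 * (1 + |(a : ℝ)|) ^ 3 := by
  have hR : (a : ℝ) + b + c = 0 := by exact_mod_cast habc
  have hcube : |(a : ℝ)| ^ 3 ≤ (1 + |(a : ℝ)|) ^ 3 := by
    gcongr
    linarith
  rcases le_or_gt |c| 1 with hc | hc
  · have hc' : |(c : ℝ)| ≤ 1 := by exact_mod_cast hc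
    have hb' : |(b : ℝ)| ≤ 1 + |(a : ℝ)| := by
      rw [show (b : ℝ) = -(c + a) by linarith, abs_neg]
      exact (abs_add_le _ _).trans (by linarith)
    have e1 : triSym j a b c = 4 * a * b * c := by simp [triSym, h0 c hc]
    have h2 : |4 * (a : ℝ) * b * c| ≤ 4 * (1 + |(a : ℝ)|) * (1 + |(a : ℝ)|) * 1 := by
      simp only [abs_mul]
      gcongr
      · norm_num
      · linarith
    have h3 : |if b * c < 0 then 2 * (a : ℝ) ^ 2 * c else 0| ≤ 2 * (1 + |(a : ℝ)|) ^ 2 * 1 := by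
      split_ifs
      · simp only [abs_mul, abs_pow, abs_two]
        gcongr
        linarith
      · simp
        positivity
    rw [e1]
    refine (abs_sub _ _).trans ?_
    have h4 : (1 + |(a : ℝ)|) ^ 2 ≤ (1 + |(a : ℝ)|) ^ 3 :=
      pow_le_pow_right₀ (by linarith [abs_nonneg (a : ℝ)]) (by norm_num)
    nlinarith [abs_nonneg (a : ℝ)]
  · have hc0 : (c : ℝ) ≠ 0 := by
      have : c ≠ 0 := by rintro rfl; simp at hc
      exact_mod_cast this
    have hj : (c.sign : ℝ) * j c = 1 / c := by
      rw [h1 c hc]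
      rcases lt_or_gt_of_ne hc0 with h | h
      · rw [Int.sign_eq_neg_one_of_neg (by exact_mod_cast h), abs_of_neg h]
        field_simp
        simp
      · rw [Int.sign_eq_one_of_pos (by exact_mod_cast h), abs_of_pos h]
        simp
    have hj' : j c = c.sign * (1 / c) := by
      rw [← hj, ← mul_assoc]
      rcases lt_or_gt_of_ne hc0 with h | h
      · rw [Int.sign_eq_neg_one_of_neg (by exact_mod_cast h)]
        simp
      · rw [Int.sign_eq_one_of_pos (by exact_mod_cast h)]
        simp
    have e1 : triSym j a b c = (a.sign : ℝ) * b.sign * (a ^ 4 / c) + (b : ℝ) ^ 4 / c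
        + b.sign * c.sign * c ^ 3 + 4 * a * b * c := by
      unfold triSym
      rw [hj, hj']
      field_simp
    rcases lt_trichotomy (b * c) 0 with hbc | hbc | hbc
    · have hsgn : (b.sign : ℝ) * c.sign = -1 := by
        rw [← Int.cast_mul, ← Int.sign_mul, Int.sign_eq_neg_one_of_neg hbc]
        simp
      have hab : |(1 + (a.sign : ℝ) * b.sign) * (a ^ 4 / c)| ≤ 2 * |(a : ℝ)| ^ 3 := by
        rcases lt_trichotomy (a * b) 0 with h | h | h
        · have : (a.sign : ℝ) * b.sign = -1 := by
            rw [← Int.cast_mul, ← Int.sign_mul, Int.sign_eq_neg_one_of_neg h]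
            simp
          rw [this]
          simp
        · have ha : a = 0 := by
            rcases mul_eq_zero.mp h with h | h
            · exact h
            · simp [h] at hbc
          simp [ha]
        · have : (a.sign : ℝ) * b.sign = 1 := by
            rw [← Int.cast_mul, ← Int.sign_mul, Int.sign_eq_one_of_pos h]
            simp
          have hab' : (0 : ℝ) < a * b := by exact_mod_cast h
          have hac : |(a : ℝ)| ≤ |(c : ℝ)| := by
            rw [← sq_le_sq, show (c : ℝ) = -(a + b) by linarith]
            nlinarith
          have hcpos : 0 < |(c : ℝ)| := abs_pos.mpr hc0
          rw [this, abs_mul, abs_div, abs_pow, show |(1 : ℝ) + 1| = 2 by norm_num]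
          refine mul_le_mul_of_nonneg_left ?_ (by norm_num)
          rw [div_le_iff₀ hcpos, pow_succ]
          gcongr
      have e2 : triSym j a b c - 2 * (a : ℝ) ^ 2 * c =
          (1 + (a.sign : ℝ) * b.sign) * (a ^ 4 / c) + 4 * a ^ 3 := by
        rw [e1, hsgn, show (b : ℝ) = -(a + c) by linarith]
        field_simp
        ring
      rw [if_pos hbc, e2]
      refine (abs_add_le _ _).trans ?_
      rw [abs_mul 4, abs_pow, abs_of_pos (four_pos : (0 : ℝ) < 4)]
      linarith [pow_nonneg (abs_nonneg (a : ℝ)) 3]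
    · have hb : b = 0 := by
        rcases mul_eq_zero.mp hbc with h | h
        · exact h
        · exact absurd (by exact_mod_cast h) hc0
      subst hb
      simp [e1]
      positivity
    · have hbc' : (0 : ℝ) < b * c := by exact_mod_cast hbc
      have hsgn : (b.sign : ℝ) * c.sign = 1 := by
        rw [← Int.cast_mul, ← Int.sign_mul, Int.sign_eq_one_of_pos hbc]
        simp
      have hsgn' : (a.sign : ℝ) * b.sign = -1 := by
        have : a * b < 0 := by
          rw [show a = -(b + c) by omega]
          nlinarith [sq_nonneg b]
        rw [← Int.cast_mul, ← Int.sign_mul, Int.sign_eq_neg_one_of_neg this]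
        simp
      have hba : |(b : ℝ)| ≤ |(a : ℝ)| := by
        rw [← sq_le_sq, show (a : ℝ) = -(b + c) by linarith]
        nlinarith
      have hca : |(c : ℝ)| ≤ |(a : ℝ)| := by
        rw [← sq_le_sq, show (a : ℝ) = -(b + c) by linarith]
        nlinarith
      have e2 : triSym j a b c =
          (a - b) * (a ^ 2 + b ^ 2) + (c : ℝ) ^ 3 + 4 * a * b * c := by
        rw [e1, hsgn, hsgn', show (b : ℝ) = -(a + c) by linarith]
        field_simp
        ring
      have t1 : |((a : ℝ) - b) * (a ^ 2 + b ^ 2)| ≤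
          (|(a : ℝ)| + |(a : ℝ)|) * (|(a : ℝ)| ^ 2 + |(a : ℝ)| ^ 2) := by
        rw [abs_mul]
        gcongr
        · exact (abs_sub _ _).trans (by linarith)
        · refine (abs_add_le _ _).trans ?_
          rw [abs_pow, abs_pow]
          gcongr
      have t2 : |(c : ℝ) ^ 3| ≤ |(a : ℝ)| ^ 3 := by
        rw [abs_pow]
        gcongr
      have t3 : |4 * (a : ℝ) * b * c| ≤ 4 * |(a : ℝ)| * |(a : ℝ)| * |(a : ℝ)| := by
        simp only [abs_mul]
        gcongr
        norm_num
      rw [if_neg (by omega), e2, sub_zero]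
      refine (abs_add_three _ _ _).trans ?_
      nlinarith

theorem abs_triSym_add_le {j : ℤ → ℝ} (h0 : ∀ n : ℤ, |n| ≤ 1 → j n = 0)
    (h1 : ∀ n : ℤ, 2 ≤ |n| → j n = 1 / |(n : ℝ)|) {a b c : ℤ} (habc : a + b + c = 0) :
    |triSym j a b c + triSym j a c b| ≤ 20 * (1 + |(a : ℝ)|) ^ 3 := by
  have hb := abs_triSym_sub_le h0 h1 habc
  have hc := abs_triSym_sub_le h0 h1 (show a + c + b = 0 by omega)
  rw [mul_comm c b] at hc
  have hR : (b : ℝ) + c = -a := by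
    have : (a : ℝ) + b + c = 0 := by exact_mod_cast habc
    linarith
  have hs : |(if b * c < 0 then 2 * (a : ℝ) ^ 2 * c else 0) +
      (if b * c < 0 then 2 * (a : ℝ) ^ 2 * b else 0)| ≤ 2 * (1 + |(a : ℝ)|) ^ 3 := by
    split_ifs
    · have : 2 * (a : ℝ) ^ 2 * c + 2 * (a : ℝ) ^ 2 * b = -(2 * a ^ 3) := by
        linear_combination 2 * (a : ℝ) ^ 2 * hR
      rw [this, abs_neg, abs_mul, abs_pow, abs_two]
      gcongr
      linarith
    · simp
      positivity
  rw [abs_le] at *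
  constructor <;> linarith [hb.1, hb.2, hc.1, hc.2, hs.1, hs.2]

/-- A trilinear Fourier sum whose symbol, symmetrized in the last two frequencies, is bounded by a
weight in the first one. -/
theorem abs_le_of_hasSum_trilinear {M : ℤ → ℤ → ℤ → ℝ} {v : ℤ → ℝ} {U W : ℤ → ℂ} {E : ℝ}
    (hM : ∀ a b c : ℤ, a + b + c = 0 → |M a b c + M a c b| ≤ v a)
    (hU : Summable fun n => v n * ‖U n‖) (hW : Summable fun n => ‖W n‖ ^ 2)
    (hE : HasSum (fun p : ℤ × ℤ => Complex.I * M p.1 p.2 (-(p.1 + p.2)) *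
      (U p.1 * W p.2 * W (-(p.1 + p.2)))) (E : ℂ)) :
    |E| ≤ (∑' n, v n * ‖U n‖) / 2 * ∑' n, ‖W n‖ ^ 2 := by
  have hv : ∀ a, 0 ≤ v a := fun a => (abs_nonneg _).trans (hM a 0 (-a) (by omega))
  have hsum := hE.add (swapFreq.hasSum_iff.mpr hE)
  have hUW : HasSum (fun p : ℤ × ℤ => v p.1 * ‖U p.1‖ * ‖W p.2‖ ^ 2)
      ((∑' n, v n * ‖U n‖) * ∑' n, ‖W n‖ ^ 2) :=
    hU.hasSum.mul hW.hasSum (hU.mul_of_nonneg hW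
      (fun n => mul_nonneg (hv n) (norm_nonneg _)) (fun n => by positivity))
  have hbd := (hUW.add (swapFreq.hasSum_iff.mpr hUW)).div_const 2
  have h := hsum.norm_le_of_bounded hbd fun p => by
    obtain ⟨a, b⟩ := p
    obtain ⟨c, hc⟩ : ∃ c, c = -(a + b) := ⟨_, rfl⟩
    have hb : -(a + c) = b := by omega
    simp only [Function.comp, swapFreq_apply, ← hc, hb]
    have e : Complex.I * M a b c * (U a * W b * W c) + Complex.I * M a c b * (U a * W c * W b)
        = Complex.I * ((M a b c + M a c b : ℝ) : ℂ) * (U a * W b * W c) := by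
      push_cast
      ring
    rw [e]
    simp only [norm_mul, Complex.norm_I, one_mul, Complex.norm_real, Real.norm_eq_abs]
    have h1 := hM a b c (by omega)
    calc |M a b c + M a c b| * (‖U a‖ * ‖W b‖ * ‖W c‖)
        ≤ v a * (‖U a‖ * ‖W b‖ * ‖W c‖) := by gcongr
      _ = v a * ‖U a‖ * (‖W b‖ * ‖W c‖) := by ring
      _ ≤ v a * ‖U a‖ * ((‖W b‖ ^ 2 + ‖W c‖ ^ 2) / 2) := by
        refine mul_le_mul_of_nonneg_left ?_ (mul_nonneg (hv a) (norm_nonneg _))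
        linarith [two_mul_le_add_sq ‖W b‖ ‖W c‖]
      _ = _ := by ring
  rw [← Complex.ofReal_add, Complex.norm_real, Real.norm_eq_abs, ← two_mul, abs_mul, abs_two] at h
  linarith

/-- `|⟨(H∂ₓ⁴u)Hw, HJw⟩ − ⟨u∂ₓ⁴w, HJw⟩ − ⟨uHw, J∂ₓ⁴w⟩ − 4⟨∂ₓu, (∂ₓw)²⟩|
≤ C‖u‖_{H^{s₀}}‖w‖_{L²}²`. -/
theorem statement16 (s₀ : ℝ) (hs₀ : 7 / 2 < s₀) (ψ : ℝ → ℝ) (hψ : IsCutoff ψ) :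
    ∃ C > (0 : ℝ), ∀ u w u1 w1 w4 Hu4 Hw HJw Jw4 : Torus → ℝ,
      Continuous u → MemHs (s₀ + 1) u →
      Continuous w → MemHs (s₀ + 1) w →
      Continuous u1 → HasSymbol symDx u u1 →
      Continuous w1 → HasSymbol symDx w w1 →
      Continuous w4 → HasSymbol (fun n => symDx n ^ 4) w w4 →
      Continuous Hu4 → HasSymbol (fun n => symH n * symDx n ^ 4) u Hu4 →
      Continuous Hw → HasSymbol symH w Hw →
      Continuous HJw → HasSymbol (fun n => symH n * symJ ψ n) w HJw →
      Continuous Jw4 → HasSymbol (fun n => symJ ψ n * symDx n ^ 4) w Jw4 →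
      |inn3 Hu4 Hw HJw - inn3 u w4 HJw - inn3 u Hw Jw4 - 4 * inn3 u1 w1 w1| ≤
        C * HsNorm s₀ u * HsNorm 0 w ^ 2 := by
  obtain ⟨-, -, -, hψ1, hψ0⟩ := hψ
  set K : ℝ := Real.sqrt (∑' n : ℤ, (1 + (n : ℝ) ^ 2) ^ (-(s₀ - 3))) with hK
  have hK0 : 0 ≤ K := Real.sqrt_nonneg _
  refine ⟨30 * K + 1, by positivity, ?_⟩
  intro u w u1 w1 w4 Hu4 Hw HJw Jw4 cu hu cw hw cu1 hu1 cw1 hw1 cw4 hw4 cHu4 hHu4 cHw hHw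
    cHJw hHJw cJw4 hJw4
  set j : ℤ → ℝ := fun n => ψ n / |(n : ℝ)| with hj
  have hj0 : ∀ n : ℤ, |n| ≤ 1 → j n = 0 := by
    intro n hn
    rw [hj]
    simp only
    rw [hψ0 n (by exact_mod_cast hn), zero_div]
  have hj1 : ∀ n : ℤ, 2 ≤ |n| → j n = 1 / |(n : ℝ)| := by
    intro n hn
    rw [hj]
    simp only
    rw [hψ1 n (by exact_mod_cast hn)]
  have su := (summable_and_tsum_le_HsNorm (t := 4) (by linarith) hu).1
  have sw := (summable_and_tsum_le_HsNorm (t := 4) (by linarith) hw).1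
  have hwt : ∀ n : ℤ, (1 + (n : ℝ) ^ 2) ^ ((4 : ℝ) / 2) = (1 + (n : ℝ) ^ 2) ^ 2 := by
    intro n
    rw [show (4 : ℝ) / 2 = 2 by norm_num, Real.rpow_two]
  simp only [hwt] at su sw
  have bH : ∀ n : ℤ, ‖symH n‖ ≤ (1 + (n : ℝ) ^ 2) ^ 2 := fun n =>
    (norm_symH_le n).trans (one_le_pow₀ (by nlinarith [sq_nonneg (n : ℝ)]))
  have bD : ∀ n : ℤ, ‖symDx n‖ ≤ (1 + (n : ℝ) ^ 2) ^ 2 := by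
    intro n
    rw [norm_symDx]
    nlinarith [sq_nonneg (|(n : ℝ)| - 1), sq_abs (n : ℝ), sq_nonneg ((n : ℝ) ^ 2)]
  have bD4 : ∀ n : ℤ, ‖symDx n ^ 4‖ ≤ (1 + (n : ℝ) ^ 2) ^ 2 := by
    intro n
    rw [norm_pow, norm_symDx]
    nlinarith [sq_abs (n : ℝ)]
  have bHD4 : ∀ n : ℤ, ‖symH n * symDx n ^ 4‖ ≤ (1 + (n : ℝ) ^ 2) ^ 2 := by
    intro n
    rw [norm_mul]
    exact (mul_le_of_le_one_left (norm_nonneg _) (norm_symH_le n)).trans (bD4 n)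
  have su0 : Summable fun n => ‖FC u n‖ :=
    HasSymbol.summable_norm_FC (m := fun _ => 1) (fun n => (one_mul _).symm)
      (fun n => by
        rw [norm_one]
        exact one_le_pow₀ (by nlinarith [sq_nonneg (n : ℝ)])) su
  have sHw := hHw.summable_norm_FC bH sw
  have H1 := hasSum_inn3 cHu4 cHw cHJw (hHu4.summable_norm_FC bHD4 su) sHw
  have H2 := hasSum_inn3 cu cw4 cHJw su0 (hw4.summable_norm_FC bD4 sw)
  have H3 := hasSum_inn3 cu cHw cJw4 su0 sHw
  have H4 := hasSum_inn3 cu1 cw1 cw1 (hu1.summable_norm_FC bD su) (hw1.summable_norm_FC bD sw)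
  have HE := ((H1.sub H2).sub H3).sub (H4.mul_left 4)
  have hE : HasSum (fun p : ℤ × ℤ => Complex.I * triSym j p.1 p.2 (-(p.1 + p.2)) *
      (FC u p.1 * FC w p.2 * FC w (-(p.1 + p.2))))
      ((inn3 Hu4 Hw HJw - inn3 u w4 HJw - inn3 u Hw Jw4 - 4 * inn3 u1 w1 w1 : ℝ) : ℂ) := by
    push_cast
    refine Eq.mpr (congrArg (fun q => HasSum q _) (funext ?_)) HE
    rintro ⟨a, b⟩
    obtain ⟨c, hc⟩ : ∃ c, c = -(a + b) := ⟨_, rfl⟩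
    simp only [← hc, hHu4 a, hHw b, hHJw c, hw4 b, hJw4 c, hu1 a, hw1 b, hw1 c]
    have hJ : symJ ψ c = (j c : ℂ) := rfl
    rw [hJ]
    simp only [symH, symDx, triSym, mul_pow, Complex.I_pow_four]
    push_cast
    linear_combination (Complex.I * ((a.sign : ℂ) * b.sign * a ^ 4 * (c.sign * j c) +
      4 * a * b * c) * (FC u a * FC w b * FC w c)) * Complex.I_sq
  obtain ⟨sA, hA⟩ := summable_and_tsum_le_HsNorm (t := 3) (by linarith)
    (hu.mono (s := s₀) (by linarith))
  have hW : Summable fun n => ‖FC w n‖ ^ 2 := by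
    have := hw.mono (s := 0) (by linarith)
    simpa [MemHs] using this
  have hfin := abs_le_of_hasSum_trilinear
    (v := fun a => 60 * (1 + (a : ℝ) ^ 2) ^ ((3 : ℝ) / 2))
    (fun a b c habc => (abs_triSym_add_le hj0 hj1 habc).trans (by
      linarith [one_add_abs_pow_three_le (a : ℝ)]))
    (by simpa only [mul_assoc] using sA.mul_left 60) hW hE
  refine hfin.trans ?_
  simp only [mul_assoc (60 : ℝ)]
  rw [tsum_mul_left, ← HsNorm_zero_sq]
  refine mul_le_mul_of_nonneg_right ?_ (sq_nonneg _)
  have : 0 ≤ HsNorm s₀ u := Real.sqrt_nonneg _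
  rw [← hK] at hA
  linarith

end
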